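/- arXiv:2108.02994 — 2 statements merged into one kernel-verified Lean document; each statement's English description precedes it below -/
import Mathlib

section
/- (Upper bound on the optimal value of the rollout ETC optimal control problem, unconstrained case.) Let g, c, b ∈ ℕ with 1 ≤ g ≤ c ≤ b, M = ⌈c/g⌉, and let the plant be unconstrained (𝕏 = ℝⁿ, 𝕌 = ℝ^m). Let Q, R be symmetric positive definite, K ∈ ℝ^{m×(n+m)}, and let P₀ be symmetric positive semidefinite satisfying the Variant-1 matrix inequality A₁ᵀ(A₀^{M−1})ᵀ P₀ A₀^{M−1} A₁ − P₀ + diag(Q, 0) + Kᵀ R K + Σ_{j=1}^{M−1} A₁ᵀ(A₀^{j−1})ᵀ diag(Q, R) A₀^{j−1} A₁ ⪯ 0. Let the horizon be N = rM with r ∈ ℕ, r ≥ 1, terminal set S = ℝ^{n+m} × (ℤ ∩ [c−g, b]) and terminal cost F(ξ) = [x; u]ᵀ P₀ [x; u]. Then for every ξ = (x₀, u₀, β₀) with β₀ ∈ ℤ ∩ [c−g, b], the optimal control problem P(ξ) — minimize Σ_{i=0}^{N−1} ℓ(ξ(i), π(i)) + F(ξ(N)) over sequences with ξ(0) = ξ,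 ξ(i+1) = f(ξ(i), π(i)), bucket levels β(i) ∈ ℤ ∩ [0, b] for all i, γ(i) ∈ {0,1}, and ξ(N) ∈ S — is feasible, and its optimal value (infimum over the feasible set) is at most [x₀; u₀]ᵀ P₀ [x₀; u₀]. -/
open Matrix

/-- Overall state of the networked control system: plant state `x`,
held input `u`, and integer bucket level `β`. -/
abbrev NCSState (n m : ℕ) := (Fin n → ℝ) × (Fin m → ℝ) × ℤ

/-- Overall input: control update `v` and transmission decision `γ ∈ {0,1}`
(modelled as a `Bool`). -/
abbrev NCSInput (n m : ℕ) := (Fin m → ℝ) × Bool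

/-- Overall dynamics
`f(ξ, π) = (Ax + Bγv + B(1-γ)u, γv + (1-γ)u, min (β + g - γc) b)`. -/
noncomputable def ncsDyn {n m : ℕ} (A : Matrix (Fin n) (Fin n) ℝ)
    (B : Matrix (Fin n) (Fin m) ℝ) (g c b : ℕ)
    (ξ : NCSState n m) (π : NCSInput n m) : NCSState n m :=
  ⟨A.mulVec ξ.1 + B.mulVec (if π.2 then π.1 else ξ.2.1),
   if π.2 then π.1 else ξ.2.1,
   min (ξ.2.2 + (g : ℤ) - if π.2 then (c : ℤ) else 0) (b : ℤ)⟩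

/-- The stacked vector `z = [x; u] ∈ ℝ^{n+m}`. -/
def vcat {n m : ℕ} (x : Fin n → ℝ) (u : Fin m → ℝ) : Fin n ⊕ Fin m → ℝ :=
  Sum.elim x u

/-- No-transmission step matrix `A₀ = [[A, B], [0, I]]`. -/
noncomputable def A0mat {n m : ℕ} (A : Matrix (Fin n) (Fin n) ℝ)
    (B : Matrix (Fin n) (Fin m) ℝ) :
    Matrix (Fin n ⊕ Fin m) (Fin n ⊕ Fin m) ℝ :=
  fromBlocks A B 0 1

/-- Transmission step matrix `A₁ = [[A, 0], [0, 0]] + [[B], [I]] K`. -/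
noncomputable def A1mat {n m : ℕ} (A : Matrix (Fin n) (Fin n) ℝ)
    (B : Matrix (Fin n) (Fin m) ℝ) (K : Matrix (Fin m) (Fin n ⊕ Fin m) ℝ) :
    Matrix (Fin n ⊕ Fin m) (Fin n ⊕ Fin m) ℝ :=
  fromBlocks A 0 0 0 + fromRows B (1 : Matrix (Fin m) (Fin m) ℝ) * K

/-- The trajectory of the overall system generated from initial state `ξ0`
by the input sequence `πs`. -/
noncomputable def ncsTraj {n m : ℕ} (A : Matrix (Fin n) (Fin n) ℝ)
    (B : Matrix (Fin n) (Fin m) ℝ) (g c b : ℕ)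
    (ξ0 : NCSState n m) (πs : ℕ → NCSInput n m) : ℕ → NCSState n m
  | 0 => ξ0
  | k + 1 => ncsDyn A B g c b (ncsTraj A B g c b ξ0 πs k) (πs k)

/-- Stage cost `ℓ(ξ, π) = xᵀQx + (1-γ)uᵀRu + γvᵀRv`. -/
noncomputable def stageCost {n m : ℕ} (Q : Matrix (Fin n) (Fin n) ℝ)
    (R : Matrix (Fin m) (Fin m) ℝ) (ξ : NCSState n m) (π : NCSInput n m) : ℝ :=
  ξ.1 ⬝ᵥ Q.mulVec ξ.1 +
    (if π.2 then π.1 ⬝ᵥ R.mulVec π.1 else ξ.2.1 ⬝ᵥ R.mulVec ξ.2.1)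

/-- Feasibility for the unconstrained-plant OCP of Statement 8: the predicted
bucket levels stay in `ℤ ∩ [0, b]` and the terminal state lies in
`S = ℝ^{n+m} × (ℤ ∩ [c-g, b])`. -/
noncomputable def FeasU {n m : ℕ} (A : Matrix (Fin n) (Fin n) ℝ)
    (B : Matrix (Fin n) (Fin m) ℝ) (g c b : ℕ)
    (ξ0 : NCSState n m) (N : ℕ) (πs : ℕ → NCSInput n m) : Prop :=
  (∀ i ≤ N, 0 ≤ (ncsTraj A B g c b ξ0 πs i).2.2 ∧
      (ncsTraj A B g c b ξ0 πs i).2.2 ≤ (b : ℤ)) ∧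
  (c : ℤ) - (g : ℤ) ≤ (ncsTraj A B g c b ξ0 πs N).2.2 ∧
  (ncsTraj A B g c b ξ0 πs N).2.2 ≤ (b : ℤ)

/-- Cost of the OCP of Statement 8: accumulated stage cost over the horizon
plus terminal cost `F(ξ) = [x; u]ᵀ P₀ [x; u]`. -/
noncomputable def costU {n m : ℕ} (A : Matrix (Fin n) (Fin n) ℝ)
    (B : Matrix (Fin n) (Fin m) ℝ) (g c b : ℕ)
    (Q : Matrix (Fin n) (Fin n) ℝ) (R : Matrix (Fin m) (Fin m) ℝ)
    (P₀ : Matrix (Fin n ⊕ Fin m) (Fin n ⊕ Fin m) ℝ)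
    (ξ0 : NCSState n m) (N : ℕ) (πs : ℕ → NCSInput n m) : ℝ :=
  ∑ i ∈ Finset.range N, stageCost Q R (ncsTraj A B g c b ξ0 πs i) (πs i) +
    vcat (ncsTraj A B g c b ξ0 πs N).1 (ncsTraj A B g c b ξ0 πs N).2.1 ⬝ᵥ
      P₀.mulVec (vcat (ncsTraj A B g c b ξ0 πs N).1 (ncsTraj A B g c b ξ0 πs N).2.1)

/-- Closed-loop input: transmit `K z` at multiples of `M`, otherwise hold. -/
noncomputable def clInput {n m : ℕ} (K : Matrix (Fin m) (Fin n ⊕ Fin m) ℝ) (M i : ℕ)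
    (ξ : NCSState n m) : NCSInput n m :=
  if i % M = 0 then (K.mulVec (vcat ξ.1 ξ.2.1), true) else (0, false)

/-- Closed-loop trajectory. -/
noncomputable def clTraj {n m : ℕ} (A : Matrix (Fin n) (Fin n) ℝ)
    (B : Matrix (Fin n) (Fin m) ℝ) (K : Matrix (Fin m) (Fin n ⊕ Fin m) ℝ) (g c b M : ℕ)
    (ξ0 : NCSState n m) : ℕ → NCSState n m
  | 0 => ξ0
  | k + 1 => ncsDyn A B g c b (clTraj A B K g c b M ξ0 k)
      (clInput K M k (clTraj A B K g c b M ξ0 k))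

lemma clTraj_succ {n m : ℕ} (A : Matrix (Fin n) (Fin n) ℝ)
    (B : Matrix (Fin n) (Fin m) ℝ) (K : Matrix (Fin m) (Fin n ⊕ Fin m) ℝ) (g c b M : ℕ)
    (ξ0 : NCSState n m) (k : ℕ) :
    clTraj A B K g c b M ξ0 (k + 1) = ncsDyn A B g c b (clTraj A B K g c b M ξ0 k)
      (clInput K M k (clTraj A B K g c b M ξ0 k)) := rfl

lemma ncsTraj_cl {n m : ℕ} (A : Matrix (Fin n) (Fin n) ℝ)
    (B : Matrix (Fin n) (Fin m) ℝ) (K : Matrix (Fin m) (Fin n ⊕ Fin m) ℝ) (g c b M : ℕ)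
    (ξ0 : NCSState n m) (k : ℕ) :
    ncsTraj A B g c b ξ0 (fun i => clInput K M i (clTraj A B K g c b M ξ0 i)) k
      = clTraj A B K g c b M ξ0 k := by
  induction k with
  | zero => rfl
  | succ k ih => simp only [ncsTraj, clTraj, ih]

lemma quad_conj {ι κ : Type*} [Fintype ι] [Fintype κ] (X : Matrix κ ι ℝ) (S : Matrix κ κ ℝ)
    (z : ι → ℝ) : z ⬝ᵥ (Xᵀ * S * X).mulVec z = X.mulVec z ⬝ᵥ S.mulVec (X.mulVec z) := by
  rw [← Matrix.mulVec_mulVec, ← Matrix.mulVec_mulVec, Matrix.dotProduct_mulVec,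
    Matrix.vecMul_transpose]

lemma vcat_A0 {n m : ℕ} (A : Matrix (Fin n) (Fin n) ℝ)
    (B : Matrix (Fin n) (Fin m) ℝ) (x : Fin n → ℝ) (u : Fin m → ℝ) :
    (A0mat A B).mulVec (vcat x u) = vcat (A.mulVec x + B.mulVec u) u := by
  simp [A0mat, vcat, Matrix.fromBlocks_mulVec]

lemma vcat_A1 {n m : ℕ} (A : Matrix (Fin n) (Fin n) ℝ)
    (B : Matrix (Fin n) (Fin m) ℝ) (K : Matrix (Fin m) (Fin n ⊕ Fin m) ℝ)
    (x : Fin n → ℝ) (u : Fin m → ℝ) :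
    (A1mat A B K).mulVec (vcat x u)
      = vcat (A.mulVec x + B.mulVec (K.mulVec (vcat x u))) (K.mulVec (vcat x u)) := by
  unfold A1mat
  rw [Matrix.add_mulVec, ← Matrix.mulVec_mulVec]
  generalize K.mulVec (vcat x u) = w
  ext (i | i) <;> simp [vcat, Matrix.fromBlocks_mulVec, Matrix.fromRows_mulVec]

lemma vcat_QR {n m : ℕ} (Q : Matrix (Fin n) (Fin n) ℝ) (R : Matrix (Fin m) (Fin m) ℝ)
    (x : Fin n → ℝ) (u : Fin m → ℝ) :
    vcat x u ⬝ᵥ (fromBlocks Q 0 0 R).mulVec (vcat x u)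
      = x ⬝ᵥ Q.mulVec x + u ⬝ᵥ R.mulVec u := by
  simp [vcat, Matrix.fromBlocks_mulVec, dotProduct]

/-- One closed-loop period, stated with `M = p + 1`. -/
lemma cl_period {n m : ℕ} (A : Matrix (Fin n) (Fin n) ℝ)
    (B : Matrix (Fin n) (Fin m) ℝ) (K : Matrix (Fin m) (Fin n ⊕ Fin m) ℝ)
    (g c b p : ℕ) (hgc : g ≤ c) (hcb : c ≤ b)
    (ξ0 : NCSState n m) (k : ℕ)
    (hk : (c : ℤ) - g ≤ (clTraj A B K g c b (p+1) ξ0 (k * (p+1))).2.2) (j : ℕ) (hj : j ≤ p) :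
    vcat (clTraj A B K g c b (p+1) ξ0 (k * (p+1) + (j+1))).1
        (clTraj A B K g c b (p+1) ξ0 (k * (p+1) + (j+1))).2.1
      = ((A0mat A B) ^ j * A1mat A B K).mulVec
          (vcat (clTraj A B K g c b (p+1) ξ0 (k * (p+1))).1
            (clTraj A B K g c b (p+1) ξ0 (k * (p+1))).2.1) ∧
    min ((j : ℤ) * g) b ≤ (clTraj A B K g c b (p+1) ξ0 (k * (p+1) + (j+1))).2.2 ∧
    (clTraj A B K g c b (p+1) ξ0 (k * (p+1) + (j+1))).2.2 ≤ b := by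
  induction j with
  | zero =>
    rw [← Nat.add_assoc, clTraj_succ, Nat.add_zero]
    simp only [clInput, ncsDyn, Nat.mul_mod_left, if_true, pow_zero, one_mul, vcat_A1]
    refine ⟨trivial, ?_, min_le_right _ _⟩
    simp
    omega
  | succ j ih =>
    obtain ⟨h1, h2, -⟩ := ih (by omega)
    have hmod : (k * (p+1) + (j+1)) % (p+1) ≠ 0 := by
      rw [Nat.mul_add_mod', Nat.mod_eq_of_lt (by omega)]
      omega
    rw [← Nat.add_assoc _ (j+1) 1, clTraj_succ]
    simp only [clInput, ncsDyn, hmod, if_false, pow_succ', Matrix.mul_assoc, Bool.false_eq_true]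
    rw [← Matrix.mulVec_mulVec, ← h1, vcat_A0]
    refine ⟨rfl, ?_, min_le_right _ _⟩
    push_cast
    rw [add_mul]
    omega

lemma stage_zero {n m : ℕ} (Q : Matrix (Fin n) (Fin n) ℝ) (R : Matrix (Fin m) (Fin m) ℝ)
    (K : Matrix (Fin m) (Fin n ⊕ Fin m) ℝ) (M i : ℕ) (hi : i % M = 0) (ξ : NCSState n m) :
    stageCost Q R ξ (clInput K M i ξ)
      = vcat ξ.1 ξ.2.1 ⬝ᵥ (fromBlocks Q 0 0 0).mulVec (vcat ξ.1 ξ.2.1) +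
        vcat ξ.1 ξ.2.1 ⬝ᵥ (Kᵀ * R * K).mulVec (vcat ξ.1 ξ.2.1) := by
  rw [quad_conj, vcat_QR]
  simp [stageCost, clInput, hi]

lemma stage_ne {n m : ℕ} (Q : Matrix (Fin n) (Fin n) ℝ) (R : Matrix (Fin m) (Fin m) ℝ)
    (K : Matrix (Fin m) (Fin n ⊕ Fin m) ℝ) (M i : ℕ) (hi : i % M ≠ 0) (ξ : NCSState n m) :
    stageCost Q R ξ (clInput K M i ξ)
      = vcat ξ.1 ξ.2.1 ⬝ᵥ (fromBlocks Q 0 0 R).mulVec (vcat ξ.1 ξ.2.1) := by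
  rw [vcat_QR]
  simp [stageCost, clInput, hi]

/-- Upper bound on the optimal value of the rollout ETC
optimal control problem (unconstrained plant, Variant 1 with horizon
`N = rM` and terminal cost `[x; u]ᵀ P₀ [x; u]`): the OCP is feasible and its
optimal value is at most `[x₀; u₀]ᵀ P₀ [x₀; u₀]`. -/
theorem rolloutETC_OCP_value_bound {n m : ℕ}
    (A : Matrix (Fin n) (Fin n) ℝ) (B : Matrix (Fin n) (Fin m) ℝ)
    (K : Matrix (Fin m) (Fin n ⊕ Fin m) ℝ)
    (g c b M : ℕ) (hg : 1 ≤ g) (hgc : g ≤ c) (hcb : c ≤ b)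
    (hM : M = ⌈(c : ℚ) / (g : ℚ)⌉₊)
    (Q : Matrix (Fin n) (Fin n) ℝ) (R : Matrix (Fin m) (Fin m) ℝ)
    (hQ : Q.PosDef) (hR : R.PosDef)
    (P₀ : Matrix (Fin n ⊕ Fin m) (Fin n ⊕ Fin m) ℝ) (hP₀ : P₀.PosSemidef)
    -- Variant-1 matrix inequality
    (hMI : (-((A1mat A B K)ᵀ * ((A0mat A B) ^ (M - 1))ᵀ * P₀ * (A0mat A B) ^ (M - 1) *
            A1mat A B K
          - P₀ + fromBlocks Q 0 0 0 + Kᵀ * R * K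
          + ∑ j ∈ Finset.Icc 1 (M - 1),
              (A1mat A B K)ᵀ * ((A0mat A B) ^ (j - 1))ᵀ * fromBlocks Q 0 0 R *
                (A0mat A B) ^ (j - 1) * A1mat A B K)).PosSemidef)
    (r N : ℕ) (hr : 1 ≤ r) (hN : N = r * M)
    (x₀ : Fin n → ℝ) (u₀ : Fin m → ℝ) (β₀ : ℤ)
    (hβ₀l : (c : ℤ) - (g : ℤ) ≤ β₀) (hβ₀u : β₀ ≤ (b : ℤ)) :
    (∃ πs : ℕ → NCSInput n m, FeasU A B g c b (x₀, u₀, β₀) N πs) ∧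
    sInf {J : ℝ | ∃ πs : ℕ → NCSInput n m,
        FeasU A B g c b (x₀, u₀, β₀) N πs ∧
        J = costU A B g c b Q R P₀ (x₀, u₀, β₀) N πs}
      ≤ vcat x₀ u₀ ⬝ᵥ P₀.mulVec (vcat x₀ u₀) := by
  have hg' : (0 : ℚ) < g := by exact_mod_cast hg
  have hMg : c ≤ M * g := by
    have h := Nat.le_ceil ((c : ℚ) / g)
    rw [← hM, div_le_iff₀ hg'] at h
    exact_mod_cast h
  have hM0 : M ≠ 0 := by
    rintro rfl
    omega
  obtain ⟨p, rfl⟩ := Nat.exists_eq_succ_of_ne_zero hM0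
  clear hM hM0
  simp only [Nat.succ_eq_add_one, Nat.add_sub_cancel] at *
  set T := clTraj A B K g c b (p+1) (x₀, u₀, β₀) with hT
  set πs : ℕ → NCSInput n m := fun i => clInput K (p+1) i (T i) with hπ
  have hTr : ∀ k, ncsTraj A B g c b (x₀, u₀, β₀) πs k = T k := fun k =>
    ncsTraj_cl A B K g c b (p+1) (x₀, u₀, β₀) k
  have hpg : (c : ℤ) - g ≤ p * g := by
    have : (c : ℤ) ≤ (p + 1) * g := by exact_mod_cast hMg
    linarith
  -- bucket level at the period starts
  have hbk : ∀ k, (c : ℤ) - g ≤ (T (k * (p+1))).2.2 ∧ (T (k * (p+1))).2.2 ≤ b := by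
    intro k
    induction k with
    | zero => simpa [hT, clTraj] using ⟨by linarith, hβ₀u⟩
    | succ k ih =>
      obtain ⟨-, h2, h3⟩ := cl_period A B K g c b p hgc hcb (x₀, u₀, β₀) k ih.1 p le_rfl
      rw [show (k + 1) * (p + 1) = k * (p+1) + (p+1) by ring]
      refine ⟨le_trans (le_min hpg ?_) h2, h3⟩
      omega
  have hb : ∀ i, 0 ≤ (T i).2.2 ∧ (T i).2.2 ≤ b := by
    intro i
    obtain ⟨k, j, hj, rfl⟩ : ∃ k j, j < p + 1 ∧ i = k * (p+1) + j :=
      ⟨i / (p+1), i % (p+1), Nat.mod_lt _ (by omega), by rw [mul_comm]; exact (Nat.div_add_mod _ _).symm⟩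
    have hk := hbk k
    rcases j with _ | j
    · rw [Nat.add_zero]
      omega
    · obtain ⟨-, h2, h3⟩ := cl_period A B K g c b p hgc hcb (x₀, u₀, β₀) k hk.1 j (by omega)
      refine ⟨le_trans (le_min (by positivity) (by positivity)) h2, h3⟩
  have hfeas : FeasU A B g c b (x₀, u₀, β₀) N πs := by
    simp only [FeasU, hTr]
    refine ⟨fun i _ => hb i, ?_⟩
    rw [hN]
    exact hbk r
  have hcost : ∀ k, ∑ i ∈ Finset.range (k * (p+1)), stageCost Q R (T i) (πs i)
      + vcat (T (k * (p+1))).1 (T (k * (p+1))).2.1 ⬝ᵥ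
        P₀.mulVec (vcat (T (k * (p+1))).1 (T (k * (p+1))).2.1)
      ≤ vcat x₀ u₀ ⬝ᵥ P₀.mulVec (vcat x₀ u₀) := by
    intro k
    induction k with
    | zero => simp [hT, clTraj]
    | succ k ih =>
      refine le_trans ?_ ih
      have hper := fun j hj =>
        (cl_period A B K g c b p hgc hcb (x₀, u₀, β₀) k (hbk k).1 j hj).1
      rw [← hT] at hper
      rw [show (k + 1) * (p + 1) = k * (p+1) + (p+1) by ring, Finset.sum_range_add,
        Finset.sum_range_succ', hper p le_rfl]
      have h0 : stageCost Q R (T (k * (p+1) + 0)) (πs (k * (p+1) + 0)) = _ :=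
        stage_zero Q R K (p+1) (k * (p+1)) (by simp) (T (k * (p+1)))
      have hs : ∀ j ∈ Finset.range p,
          stageCost Q R (T (k * (p+1) + (j+1))) (πs (k * (p+1) + (j+1))) =
          vcat (T (k * (p+1))).1 (T (k * (p+1))).2.1 ⬝ᵥ
          ((A1mat A B K)ᵀ * ((A0mat A B) ^ j)ᵀ * fromBlocks Q 0 0 R *
                (A0mat A B) ^ j * A1mat A B K).mulVec
            (vcat (T (k * (p+1))).1 (T (k * (p+1))).2.1) := by
        intro j hj
        have hj := Finset.mem_range.1 hj
        have hmod : (k * (p+1) + (j+1)) % (p+1) ≠ 0 := by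
          rw [Nat.mul_add_mod', Nat.mod_eq_of_lt (by omega)]
          omega
        have h1 : stageCost Q R (T (k * (p+1) + (j+1))) (πs (k * (p+1) + (j+1))) = _ :=
          stage_ne Q R K (p+1) _ hmod (T (k * (p+1) + (j+1)))
        rw [h1, hper j hj.le, ← quad_conj, Matrix.transpose_mul]
        simp only [Matrix.mul_assoc]
      rw [h0, Finset.sum_congr rfl hs]
      have hI : ∑ j ∈ Finset.Icc 1 p,
              (A1mat A B K)ᵀ * ((A0mat A B) ^ (j - 1))ᵀ * fromBlocks Q 0 0 R *
                (A0mat A B) ^ (j - 1) * A1mat A B K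
          = ∑ j ∈ Finset.range p, (A1mat A B K)ᵀ * ((A0mat A B) ^ j)ᵀ * fromBlocks Q 0 0 R *
                (A0mat A B) ^ j * A1mat A B K := by
        rw [Finset.range_eq_Ico, ← Finset.Ico_add_one_right_eq_Icc, ← Finset.sum_Ico_add' _ 0 p 1]
        simp
      rw [hI] at hMI
      generalize vcat (T (k * (p+1))).1 (T (k * (p+1))).2.1 = z
      have hz := hMI.dotProduct_mulVec_nonneg z
      rw [← quad_conj, Matrix.transpose_mul]
      simp only [star_trivial, Matrix.neg_mulVec, Matrix.add_mulVec, Matrix.sub_mulVec,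
        Matrix.sum_mulVec, dotProduct_neg, dotProduct_add, dotProduct_sub, dotProduct_sum,
        Matrix.mul_assoc] at hz ⊢
      linarith
  refine ⟨⟨πs, hfeas⟩, ?_⟩
  refine le_trans (csInf_le ⟨0, ?_⟩ ⟨πs, hfeas, rfl⟩) ?_
  · rintro J ⟨ρ, -, rfl⟩
    have q1 : ∀ x, 0 ≤ x ⬝ᵥ Q.mulVec x := fun x => by
      simpa using hQ.posSemidef.dotProduct_mulVec_nonneg x
    have q2 : ∀ x, 0 ≤ x ⬝ᵥ R.mulVec x := fun x => by
      simpa using hR.posSemidef.dotProduct_mulVec_nonneg x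
    have q3 : ∀ x, 0 ≤ x ⬝ᵥ P₀.mulVec x := fun x => by
      simpa using hP₀.dotProduct_mulVec_nonneg x
    refine add_nonneg (Finset.sum_nonneg fun i _ => add_nonneg (q1 _) ?_) (q3 _)
    split_ifs
    · exact q2 _
    · exact q2 _
  · simp only [costU, hTr]
    rw [hN]
    exact hcost r
end

section
/- (Theorem 4: flexibility of rollout ETC with terminal cost on the bucket level.) Consider the networked control system with token bucket traffic specification and rollout ETC in Variant 1 (terminal set S = Z₀ × (ℤ ∩ [c−g, b]) with Z₀ ⊆ 𝕏 × 𝕌 a closed set containing the origin satisfying A₀^j A₁ Z₀ ⊆ 𝕏 × 𝕌 for j = 0, …, M−2, A₀^{M−1} A₁ Z₀ ⊆ Z₀ and K Z₀ ⊆ 𝕌; P₀ symmetric positive semidefinite satisfying the Variant-1 matrix inequality; horizon N(k) = N̄ − (k mod M), N̄ ≥ M), but with the modified terminal cost Ṽ_f(ξ, k) = [x; u]ᵀ P₀ [x; u] + σ(b² − β²) for a constant σ > 0. If the optimal control problem P(ξ(0), 0) is feasible, then along every closed-loop trajectory ξ(k+1) = f(ξ(k), π(k)) in which each π(k) is the first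 element of a minimizer of P(ξ(k), k): (i) P(ξ(k), k) is feasible for every k; (ii) ξ(k) ∈ Ξ and π(k) ∈ Π for every k; (iii) (x(k), u(k)) → (0, 0) as k → ∞; and moreover, (iv) if c/g ∉ ℕ, then the bucket level converges to the upper sector of the bucket: there exists K₀ ∈ ℕ such that max(0, b − N̄·g) ≤ β(k) ≤ b for all k ≥ K₀. -/
open Matrix

/-- Feasibility for the constrained OCP: state constraints
`ξ(i) ∈ Ξ = 𝕏 × 𝕌 × (ℤ ∩ [0, b])` and input constraints
`π(i) ∈ Π = 𝕌 × {0,1}` for `i = 0, …, N-1`, and terminal constraint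
`ξ(N) ∈ Ξf`. -/
noncomputable def FeasOCP {n m : ℕ} (A : Matrix (Fin n) (Fin n) ℝ)
    (B : Matrix (Fin n) (Fin m) ℝ) (g c b : ℕ)
    (𝕏 : Set (Fin n → ℝ)) (𝕌 : Set (Fin m → ℝ))
    (ξ0 : NCSState n m) (N : ℕ) (Ξf : Set (NCSState n m))
    (πs : ℕ → NCSInput n m) : Prop :=
  (∀ i < N, (ncsTraj A B g c b ξ0 πs i).1 ∈ 𝕏 ∧
      (ncsTraj A B g c b ξ0 πs i).2.1 ∈ 𝕌 ∧
      0 ≤ (ncsTraj A B g c b ξ0 πs i).2.2 ∧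
      (ncsTraj A B g c b ξ0 πs i).2.2 ≤ (b : ℤ) ∧
      (πs i).1 ∈ 𝕌) ∧
  ncsTraj A B g c b ξ0 πs N ∈ Ξf

/-- Cost of the OCP with horizon `N` and terminal cost `Vf`:
`Σ_{i<N} ℓ(ξ(i), π(i)) + Vf(ξ(N))`. -/
noncomputable def costGen {n m : ℕ} (A : Matrix (Fin n) (Fin n) ℝ)
    (B : Matrix (Fin n) (Fin m) ℝ) (g c b : ℕ)
    (Q : Matrix (Fin n) (Fin n) ℝ) (R : Matrix (Fin m) (Fin m) ℝ)
    (Vf : NCSState n m → ℝ)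
    (ξ0 : NCSState n m) (N : ℕ) (πs : ℕ → NCSInput n m) : ℝ :=
  ∑ i ∈ Finset.range N, stageCost Q R (ncsTraj A B g c b ξ0 πs i) (πs i) +
    Vf (ncsTraj A B g c b ξ0 πs N)


section Helpers

variable {n m : ℕ}

theorem posDef_lower {p : ℕ} (Q : Matrix (Fin p) (Fin p) ℝ) (hQ : Q.PosDef) :
    ∃ ε > 0, ∀ x : Fin p → ℝ, ε * ‖x‖ ^ 2 ≤ x ⬝ᵥ Q.mulVec x := by
  have hc : Continuous (fun x : Fin p → ℝ => x ⬝ᵥ Q.mulVec x) := by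
    unfold Matrix.mulVec dotProduct
    fun_prop
  have hpos : ∀ x : Fin p → ℝ, x ≠ 0 → 0 < x ⬝ᵥ Q.mulVec x := by
    intro x hx
    simpa using hQ.dotProduct_mulVec_pos hx
  by_cases hne : (Metric.sphere (0 : Fin p → ℝ) 1).Nonempty
  · obtain ⟨y, hy, hmin⟩ := (isCompact_sphere (0 : Fin p → ℝ) 1).exists_isMinOn hne hc.continuousOn
    have hy1 : ‖y‖ = 1 := by simpa using hy
    have hy0 : y ≠ 0 := by
      rintro rfl
      simp at hy1
    refine ⟨_, hpos y hy0, fun x => ?_⟩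
    by_cases hx : x = 0
    · simp [hx]
    have hn : 0 < ‖x‖ := norm_pos_iff.mpr hx
    have hmem : (‖x‖⁻¹ • x) ∈ Metric.sphere (0 : Fin p → ℝ) 1 := by
      simp [norm_smul, hn.ne']
    have h1 : y ⬝ᵥ Q.mulVec y ≤ (‖x‖⁻¹ • x) ⬝ᵥ Q.mulVec (‖x‖⁻¹ • x) := hmin hmem
    have h2 : x = ‖x‖ • (‖x‖⁻¹ • x) := by
      rw [smul_smul, mul_inv_cancel₀ hn.ne', one_smul]
    have h3 : x ⬝ᵥ Q.mulVec x = ‖x‖ ^ 2 * ((‖x‖⁻¹ • x) ⬝ᵥ Q.mulVec (‖x‖⁻¹ • x)) := by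
      simp only [mulVec_smul, dotProduct_smul, smul_dotProduct, smul_eq_mul]
      field_simp
    rw [h3, mul_comm]
    exact mul_le_mul_of_nonneg_left h1 (by positivity)
  · refine ⟨1, one_pos, fun x => ?_⟩
    by_cases hx : x = 0
    · simp [hx]
    exfalso
    apply hne
    have hn : 0 < ‖x‖ := norm_pos_iff.mpr hx
    exact ⟨‖x‖⁻¹ • x, by simp [norm_smul, hn.ne']⟩

theorem posDef_tendsto {p : ℕ} (Q : Matrix (Fin p) (Fin p) ℝ) (hQ : Q.PosDef)
    (x : ℕ → Fin p → ℝ)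
    (h : Filter.Tendsto (fun k => x k ⬝ᵥ Q.mulVec (x k)) Filter.atTop (nhds 0)) :
    Filter.Tendsto x Filter.atTop (nhds 0) := by
  obtain ⟨ε, hε, hb⟩ := posDef_lower Q hQ
  have h1 : Filter.Tendsto (fun k => ‖x k‖ ^ 2) Filter.atTop (nhds 0) := by
    have h2 := h.const_mul ε⁻¹
    rw [mul_zero] at h2
    refine squeeze_zero (fun k => by positivity) (fun k => ?_) h2
    rw [inv_mul_eq_div, le_div_iff₀ hε, mul_comm]
    exact hb _
  have h3 := h1.sqrt
  simp only [Real.sqrt_zero, Real.sqrt_sq (norm_nonneg _)] at h3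
  exact tendsto_zero_iff_norm_tendsto_zero.mpr h3

theorem posDef_nonneg {p : ℕ} (Q : Matrix (Fin p) (Fin p) ℝ) (hQ : Q.PosDef)
    (x : Fin p → ℝ) : 0 ≤ x ⬝ᵥ Q.mulVec x := by
  simpa using hQ.posSemidef.dotProduct_mulVec_nonneg x

variable (A : Matrix (Fin n) (Fin n) ℝ) (B : Matrix (Fin n) (Fin m) ℝ) (g c b : ℕ)

theorem ncsTraj_add (ξ : NCSState n m) (πs : ℕ → NCSInput n m) (N j : ℕ) :
    ncsTraj A B g c b ξ πs (N + j) =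
      ncsTraj A B g c b (ncsTraj A B g c b ξ πs N) (fun i => πs (N + i)) j := by
  induction j with
  | zero => rfl
  | succ j ih =>
    rw [← add_assoc]
    simp only [ncsTraj]
    rw [ih]

theorem ncsTraj_congr (ξ : NCSState n m) (πs πs' : ℕ → NCSInput n m) (k : ℕ)
    (h : ∀ i < k, πs i = πs' i) :
    ncsTraj A B g c b ξ πs k = ncsTraj A B g c b ξ πs' k := by
  induction k with
  | zero => rfl
  | succ j ih =>
    simp only [ncsTraj]
    rw [ih (fun i hi => h i (by omega)), h j (by omega)]

theorem ncsTraj_shift (ξ : NCSState n m) (πs : ℕ → NCSInput n m) (j : ℕ) :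
    ncsTraj A B g c b ξ πs (j + 1) =
      ncsTraj A B g c b (ncsDyn A B g c b ξ (πs 0)) (fun i => πs (i + 1)) j := by
  rw [add_comm j 1, ncsTraj_add]
  simp only [ncsTraj, add_comm 1]

/-- Splitting the OCP of horizon `N + M`. -/
theorem ocp_concat (𝕏 : Set (Fin n → ℝ)) (𝕌 : Set (Fin m → ℝ))
    (Q : Matrix (Fin n) (Fin n) ℝ) (R : Matrix (Fin m) (Fin m) ℝ)
    (Vf : NCSState n m → ℝ) (S : Set (NCSState n m)) (ξ : NCSState n m)
    (N M : ℕ) (πs ps : ℕ → NCSInput n m)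
    (h1 : FeasOCP A B g c b 𝕏 𝕌 ξ N S πs)
    (h2 : FeasOCP A B g c b 𝕏 𝕌 (ncsTraj A B g c b ξ πs N) M S ps) :
    ∃ πs', FeasOCP A B g c b 𝕏 𝕌 ξ (N + M) S πs' ∧
      costGen A B g c b Q R Vf ξ (N + M) πs' =
        costGen A B g c b Q R Vf ξ N πs - Vf (ncsTraj A B g c b ξ πs N) +
          costGen A B g c b Q R Vf (ncsTraj A B g c b ξ πs N) M ps := by
  set q : ℕ → NCSInput n m := fun i => if i < N then πs i else ps (i - N) with hq
  have hql : ∀ i < N, q i = πs i := fun i hi => by simp [hq, hi]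
  have hqr : (fun i => q (N + i)) = ps := by
    funext i
    simp [hq]
  have htl : ∀ i ≤ N, ncsTraj A B g c b ξ q i = ncsTraj A B g c b ξ πs i := fun i hi =>
    ncsTraj_congr A B g c b ξ q πs i (fun j hj => hql j (by omega))
  have htr : ∀ j, ncsTraj A B g c b ξ q (N + j) =
      ncsTraj A B g c b (ncsTraj A B g c b ξ πs N) ps j := fun j => by
    rw [ncsTraj_add, hqr, htl N le_rfl]
  refine ⟨q, ⟨fun i hi => ?_, ?_⟩, ?_⟩
  · by_cases hiN : i < N
    · rw [htl i hiN.le, hql i hiN]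
      exact h1.1 i hiN
    · obtain ⟨j, rfl⟩ := Nat.exists_eq_add_of_le (not_lt.mp hiN)
      rw [htr j, show q (N + j) = ps j from congrFun hqr j]
      exact h2.1 j (by omega)
  · rw [htr]
    exact h2.2
  · unfold costGen
    rw [Finset.sum_range_add, htr]
    have e1 : ∑ i ∈ Finset.range N, stageCost Q R (ncsTraj A B g c b ξ q i) (q i) =
        ∑ i ∈ Finset.range N, stageCost Q R (ncsTraj A B g c b ξ πs i) (πs i) := by
      refine Finset.sum_congr rfl fun i hi => ?_
      have hi' := Finset.mem_range.mp hi
      rw [htl i hi'.le, hql i hi']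
    have e2 : ∑ i ∈ Finset.range M, stageCost Q R (ncsTraj A B g c b ξ q (N + i)) (q (N + i)) =
        ∑ i ∈ Finset.range M,
          stageCost Q R (ncsTraj A B g c b (ncsTraj A B g c b ξ πs N) ps i) (ps i) := by
      refine Finset.sum_congr rfl fun i _ => ?_
      rw [htr i, show q (N + i) = ps i from congrFun hqr i]
    rw [e1, e2]
    ring

/-- Shifting the OCP by one step. -/
theorem ocp_shift (𝕏 : Set (Fin n → ℝ)) (𝕌 : Set (Fin m → ℝ))
    (Q : Matrix (Fin n) (Fin n) ℝ) (R : Matrix (Fin m) (Fin m) ℝ)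
    (Vf : NCSState n m → ℝ) (S : Set (NCSState n m)) (ξ : NCSState n m)
    (N : ℕ) (πs : ℕ → NCSInput n m)
    (h1 : FeasOCP A B g c b 𝕏 𝕌 ξ (N + 1) S πs) :
    FeasOCP A B g c b 𝕏 𝕌 (ncsDyn A B g c b ξ (πs 0)) N S (fun i => πs (i + 1)) ∧
      costGen A B g c b Q R Vf ξ (N + 1) πs = stageCost Q R ξ (πs 0) +
        costGen A B g c b Q R Vf (ncsDyn A B g c b ξ (πs 0)) N (fun i => πs (i + 1)) := by
  refine ⟨⟨fun i hi => ?_, ?_⟩, ?_⟩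
  · rw [← ncsTraj_shift]
    exact h1.1 (i + 1) (by omega)
  · rw [← ncsTraj_shift]
    exact h1.2
  · unfold costGen
    rw [Finset.sum_range_succ', ncsTraj_shift]
    simp only [ncsTraj_shift A B g c b ξ πs]
    simp only [ncsTraj]
    ring

theorem vcat_dyn_false (ξ : NCSState n m) (v : Fin m → ℝ) :
    vcat (ncsDyn A B g c b ξ (v, false)).1 (ncsDyn A B g c b ξ (v, false)).2.1 =
      (A0mat A B).mulVec (vcat ξ.1 ξ.2.1) := by
  simp [ncsDyn, vcat, A0mat, fromBlocks_mulVec]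

theorem vcat_dyn_true (K : Matrix (Fin m) (Fin n ⊕ Fin m) ℝ) (ξ : NCSState n m) :
    vcat (ncsDyn A B g c b ξ (K.mulVec (vcat ξ.1 ξ.2.1), true)).1
        (ncsDyn A B g c b ξ (K.mulVec (vcat ξ.1 ξ.2.1), true)).2.1 =
      (A1mat A B K).mulVec (vcat ξ.1 ξ.2.1) := by
  unfold A1mat
  rw [add_mulVec, ← mulVec_mulVec, fromRows_mulVec, fromBlocks_mulVec]
  ext i
  rcases i with i | i
  · simp [ncsDyn, vcat]
  · simp [ncsDyn, vcat]

/-- input sequence over one base period -/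
def baseInput (K : Matrix (Fin m) (Fin n ⊕ Fin m) ℝ) (ξ : NCSState n m) : ℕ → NCSInput n m
  | 0 => (K.mulVec (vcat ξ.1 ξ.2.1), true)
  | _ + 1 => (0, false)

theorem base_z (K : Matrix (Fin m) (Fin n ⊕ Fin m) ℝ) (ξ : NCSState n m) (j : ℕ) :
    vcat (ncsTraj A B g c b ξ (baseInput K ξ) (j + 1)).1
        (ncsTraj A B g c b ξ (baseInput K ξ) (j + 1)).2.1 =
      ((A0mat A B) ^ j * A1mat A B K).mulVec (vcat ξ.1 ξ.2.1) := by
  induction j with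
  | zero =>
    simp only [pow_zero, one_mul]
    exact vcat_dyn_true A B g c b K ξ
  | succ j ih =>
    rw [pow_succ', mul_assoc, ← mulVec_mulVec, ← ih]
    exact vcat_dyn_false A B g c b _ _

theorem base_beta (hgc : g ≤ c) (K : Matrix (Fin m) (Fin n ⊕ Fin m) ℝ) (ξ : NCSState n m)
    (hβ : ξ.2.2 ≤ (b : ℤ)) (j : ℕ) :
    (ncsTraj A B g c b ξ (baseInput K ξ) (j + 1)).2.2 =
      min (ξ.2.2 + (j + 1) * g - c) b := by
  induction j with
  | zero =>
    simp [ncsTraj, ncsDyn, baseInput]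
  | succ j ih =>
    have : (ncsTraj A B g c b ξ (baseInput K ξ) (j + 1 + 1)).2.2 =
      min ((ncsTraj A B g c b ξ (baseInput K ξ) (j + 1)).2.2 + g - 0) b := by
      simp [ncsTraj, ncsDyn, baseInput]
    rw [this, ih]
    have e : ((j : ℤ) + 1 + 1) * g = (j + 1) * g + g := by ring
    push_cast
    rw [e]
    omega

theorem quad_sandwich {ι κ : Type*} [Fintype ι] [Fintype κ] (X : Matrix κ ι ℝ)
    (P : Matrix κ κ ℝ) (z : ι → ℝ) :
    z ⬝ᵥ (Xᵀ * P * X).mulVec z = X.mulVec z ⬝ᵥ P.mulVec (X.mulVec z) := by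
  rw [Matrix.mul_assoc, ← mulVec_mulVec, ← mulVec_mulVec, dotProduct_mulVec, vecMul_transpose]

theorem quad_blocks (Q : Matrix (Fin n) (Fin n) ℝ) (R : Matrix (Fin m) (Fin m) ℝ)
    (x : Fin n → ℝ) (u : Fin m → ℝ) :
    vcat x u ⬝ᵥ (fromBlocks Q 0 0 R).mulVec (vcat x u) = x ⬝ᵥ Q.mulVec x + u ⬝ᵥ R.mulVec u := by
  have h1 : (Sum.elim x u) ∘ Sum.inl = x := rfl
  have h2 : (Sum.elim x u) ∘ Sum.inr = u := rfl
  simp [vcat, fromBlocks_mulVec, h1, h2]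

theorem base_cost (K : Matrix (Fin m) (Fin n ⊕ Fin m) ℝ) (M : ℕ) (hM1 : 1 ≤ M)
    (Q : Matrix (Fin n) (Fin n) ℝ) (R : Matrix (Fin m) (Fin m) ℝ)
    (P₀ : Matrix (Fin n ⊕ Fin m) (Fin n ⊕ Fin m) ℝ)
    (hMI : (-((A1mat A B K)ᵀ * ((A0mat A B) ^ (M - 1))ᵀ * P₀ * (A0mat A B) ^ (M - 1) *
            A1mat A B K
          - P₀ + fromBlocks Q 0 0 0 + Kᵀ * R * K
          + ∑ j ∈ Finset.Icc 1 (M - 1),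
              (A1mat A B K)ᵀ * ((A0mat A B) ^ (j - 1))ᵀ * fromBlocks Q 0 0 R *
                (A0mat A B) ^ (j - 1) * A1mat A B K)).PosSemidef)
    (ξ : NCSState n m) :
    costGen A B g c b Q R (fun ξ => vcat ξ.1 ξ.2.1 ⬝ᵥ P₀.mulVec (vcat ξ.1 ξ.2.1)) ξ M
      (baseInput K ξ) ≤ vcat ξ.1 ξ.2.1 ⬝ᵥ P₀.mulVec (vcat ξ.1 ξ.2.1) := by
  obtain ⟨M, rfl⟩ : ∃ M', M = M' + 1 := ⟨M - 1, by omega⟩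
  simp only [Nat.add_sub_cancel] at hMI
  set z := vcat ξ.1 ξ.2.1 with hz
  have h := hMI.dotProduct_mulVec_nonneg z
  simp only [star_trivial] at h
  have hsand : ∀ (j : ℕ) (P : Matrix (Fin n ⊕ Fin m) (Fin n ⊕ Fin m) ℝ),
      z ⬝ᵥ ((A1mat A B K)ᵀ * ((A0mat A B) ^ j)ᵀ * P * (A0mat A B) ^ j * A1mat A B K).mulVec z
      = ((A0mat A B) ^ j * A1mat A B K).mulVec z ⬝ᵥ
        P.mulVec (((A0mat A B) ^ j * A1mat A B K).mulVec z) := by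
    intro j P
    rw [← quad_sandwich, transpose_mul]
    simp only [mul_assoc]
  rw [neg_mulVec, dotProduct_neg, add_mulVec, add_mulVec, add_mulVec, sub_mulVec,
    dotProduct_add, dotProduct_add, dotProduct_add, dotProduct_sub, hsand, quad_sandwich,
    sum_mulVec, dotProduct_sum] at h
  simp only [hsand] at h
  rw [hz, quad_blocks, ← hz] at h
  rw [show Finset.Icc 1 M = Finset.Ico (0+1) (M+1) from rfl,
    ← Finset.sum_Ico_add' _ 0 M 1, ← Finset.range_eq_Ico] at h
  simp only [Nat.add_sub_cancel, zero_mulVec, dotProduct_zero, add_zero] at h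
  unfold costGen
  rw [Finset.sum_range_succ']
  beta_reduce
  rw [base_z]
  have e : ∀ i, stageCost Q R (ncsTraj A B g c b ξ (baseInput K ξ) (i + 1))
      (baseInput K ξ (i + 1)) = ((A0mat A B) ^ i * A1mat A B K).mulVec z ⬝ᵥ
        (fromBlocks Q 0 0 R).mulVec (((A0mat A B) ^ i * A1mat A B K).mulVec z) := by
    intro i
    rw [hz, ← base_z A B g c b, quad_blocks]
    simp [stageCost, baseInput]
  have e0 : stageCost Q R (ncsTraj A B g c b ξ (baseInput K ξ) 0) (baseInput K ξ 0) =
      ξ.1 ⬝ᵥ Q.mulVec ξ.1 + K.mulVec z ⬝ᵥ R.mulVec (K.mulVec z) := by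
    simp [stageCost, baseInput, ncsTraj, hz]
  simp only [e, e0, ← hz]
  linarith

theorem base_step (hg : 1 ≤ g) (hgc : g ≤ c)
    (K : Matrix (Fin m) (Fin n ⊕ Fin m) ℝ) (M : ℕ) (hM1 : 1 ≤ M) (hMg : c ≤ M * g)
    (𝕏 : Set (Fin n → ℝ)) (𝕌 : Set (Fin m → ℝ)) (hU0 : (0 : Fin m → ℝ) ∈ 𝕌)
    (Z₀ : Set (Fin n ⊕ Fin m → ℝ))
    (hZsub : ∀ z ∈ Z₀, (fun i => z (Sum.inl i)) ∈ 𝕏 ∧ (fun i => z (Sum.inr i)) ∈ 𝕌)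
    (hinv1 : ∀ j : ℕ, j + 2 ≤ M → ∀ z ∈ Z₀,
      (fun i => (((A0mat A B) ^ j * A1mat A B K).mulVec z) (Sum.inl i)) ∈ 𝕏 ∧
      (fun i => (((A0mat A B) ^ j * A1mat A B K).mulVec z) (Sum.inr i)) ∈ 𝕌)
    (hinv2 : ∀ z ∈ Z₀, ((A0mat A B) ^ (M - 1) * A1mat A B K).mulVec z ∈ Z₀)
    (hK : ∀ z ∈ Z₀, K.mulVec z ∈ 𝕌)
    (Q : Matrix (Fin n) (Fin n) ℝ) (R : Matrix (Fin m) (Fin m) ℝ)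
    (P₀ : Matrix (Fin n ⊕ Fin m) (Fin n ⊕ Fin m) ℝ)
    (hMI : (-((A1mat A B K)ᵀ * ((A0mat A B) ^ (M - 1))ᵀ * P₀ * (A0mat A B) ^ (M - 1) *
            A1mat A B K
          - P₀ + fromBlocks Q 0 0 0 + Kᵀ * R * K
          + ∑ j ∈ Finset.Icc 1 (M - 1),
              (A1mat A B K)ᵀ * ((A0mat A B) ^ (j - 1))ᵀ * fromBlocks Q 0 0 R *
                (A0mat A B) ^ (j - 1) * A1mat A B K)).PosSemidef)
    (σ : ℝ) (hσ : 0 < σ) (ξ : NCSState n m)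
    (hξ : vcat ξ.1 ξ.2.1 ∈ Z₀ ∧ (c : ℤ) - (g : ℤ) ≤ ξ.2.2 ∧ ξ.2.2 ≤ (b : ℤ)) :
    ∃ ps, FeasOCP A B g c b 𝕏 𝕌 ξ M {ξ : NCSState n m | vcat ξ.1 ξ.2.1 ∈ Z₀ ∧
          (c : ℤ) - (g : ℤ) ≤ ξ.2.2 ∧ ξ.2.2 ≤ (b : ℤ)} ps ∧
      costGen A B g c b Q R (fun ξ => vcat ξ.1 ξ.2.1 ⬝ᵥ P₀.mulVec (vcat ξ.1 ξ.2.1) +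
                σ * ((b : ℝ) ^ 2 - (ξ.2.2 : ℝ) ^ 2)) ξ M ps +
        (if ¬ g ∣ c ∧ ξ.2.2 < (b : ℤ) then σ else 0) ≤
      vcat ξ.1 ξ.2.1 ⬝ᵥ P₀.mulVec (vcat ξ.1 ξ.2.1) + σ * ((b : ℝ) ^ 2 - (ξ.2.2 : ℝ) ^ 2) := by
  obtain ⟨hz, hβ1, hβ2⟩ := hξ
  have hbase := base_cost A B g c b K M hM1 Q R P₀ hMI ξ
  obtain ⟨L, rfl⟩ : ∃ M', M = M' + 1 := ⟨M - 1, by omega⟩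
  have hβf := base_beta A B g c b hgc K ξ hβ2 L
  have hMg' : (c : ℤ) ≤ (L + 1) * g := by exact_mod_cast hMg
  have hgc' : (g : ℤ) ≤ c := by exact_mod_cast hgc
  set β' := (ncsTraj A B g c b ξ (baseInput K ξ) (L + 1)).2.2 with hβ'
  have hle : ξ.2.2 ≤ β' := by omega
  refine ⟨baseInput K ξ, ⟨fun i hi => ?_, ?_, ?_, ?_⟩, ?_⟩
  · rcases i with _ | i
    · obtain ⟨h1, h2⟩ := hZsub _ hz
      exact ⟨h1, h2, by simp only [ncsTraj]; omega, hβ2, hK _ hz⟩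
    · obtain ⟨h1, h2⟩ := hinv1 i (by omega) _ hz
      rw [← base_z A B g c b] at h1 h2
      have hb := base_beta A B g c b hgc K ξ hβ2 i
      have hig : (0 : ℤ) ≤ i * g := by positivity
      have e : ((i : ℤ) + 1) * g = i * g + g := by ring
      rw [e] at hb
      exact ⟨h1, h2, by omega, by omega, hU0⟩
  · rw [base_z]
    exact hinv2 _ hz
  · omega
  · omega
  · unfold costGen at hbase ⊢
    simp only [← hβ'] at hbase ⊢
    have hβ0 : (0 : ℝ) ≤ ξ.2.2 := by
      have : (0 : ℤ) ≤ ξ.2.2 := by omega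
      exact_mod_cast this
    have key : (if ¬ g ∣ c ∧ ξ.2.2 < (b : ℤ) then σ else 0) ≤
        σ * ((β' : ℝ) ^ 2 - (ξ.2.2 : ℝ) ^ 2) := by
      split_ifs with hcond
      · have hne : (c : ℤ) ≠ (L + 1) * g := by
          intro heq
          apply hcond.1
          refine ⟨L + 1, ?_⟩
          rw [mul_comm]
          exact_mod_cast heq
        have h1 : ξ.2.2 + 1 ≤ β' := by
          have := hcond.2
          omega
        have h2 : (ξ.2.2 : ℝ) + 1 ≤ β' := by exact_mod_cast h1
        have h3 : (1 : ℝ) ≤ (β' : ℝ) ^ 2 - (ξ.2.2 : ℝ) ^ 2 := by nlinarith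
        nlinarith
      · have h2 : (ξ.2.2 : ℝ) ≤ β' := by exact_mod_cast hle
        apply mul_nonneg hσ.le
        nlinarith
    linarith

theorem traj_beta_le (ξ : NCSState n m) (πs : ℕ → NCSInput n m) (j : ℕ) :
    (ncsTraj A B g c b ξ πs j).2.2 ≤ ξ.2.2 + j * g := by
  induction j with
  | zero => simp [ncsTraj]
  | succ j ih =>
    have : (ncsTraj A B g c b ξ πs (j + 1)).2.2 ≤ (ncsTraj A B g c b ξ πs j).2.2 + g := by
      simp only [ncsTraj, ncsDyn]
      split_ifs <;> omega
    push_cast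
    have e : ((j : ℤ) + 1) * g = j * g + g := by ring
    omega

theorem stageCost_eq (Q : Matrix (Fin n) (Fin n) ℝ) (R : Matrix (Fin m) (Fin m) ℝ)
    (ξ : NCSState n m) (π : NCSInput n m) :
    stageCost Q R ξ π = ξ.1 ⬝ᵥ Q.mulVec ξ.1 +
      (ncsDyn A B g c b ξ π).2.1 ⬝ᵥ R.mulVec (ncsDyn A B g c b ξ π).2.1 := by
  simp only [stageCost, ncsDyn]
  split_ifs <;> rfl

end Helpers


/-- **Theorem 4.** Flexibility of rollout ETC with a terminal
cost on the bucket level: Variant 1 with the modified terminal cost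
`Ṽ_f(ξ) = [x; u]ᵀ P₀ [x; u] + σ (b² - β²)`, `σ > 0`, retains recursive
feasibility, constraint satisfaction and convergence of `(x, u)` to `0`;
moreover, if `c/g ∉ ℕ`, the bucket level converges to the upper sector of
the bucket: eventually `max(0, b - N̄ g) ≤ β(k) ≤ b`. -/
theorem rolloutETC_variant1_flexibility {n m : ℕ}
    (A : Matrix (Fin n) (Fin n) ℝ) (B : Matrix (Fin n) (Fin m) ℝ)
    (K : Matrix (Fin m) (Fin n ⊕ Fin m) ℝ)
    (g c b M : ℕ) (hg : 1 ≤ g) (hgc : g ≤ c) (hcb : c ≤ b)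
    (hM : M = ⌈(c : ℚ) / (g : ℚ)⌉₊)
    (𝕏 : Set (Fin n → ℝ)) (𝕌 : Set (Fin m → ℝ))
    (hXc : IsClosed 𝕏) (hUc : IsClosed 𝕌)
    (hX0 : (0 : Fin n → ℝ) ∈ 𝕏) (hU0 : (0 : Fin m → ℝ) ∈ 𝕌)
    -- Variant-1 terminal set conditions
    (Z₀ : Set (Fin n ⊕ Fin m → ℝ)) (hZc : IsClosed Z₀)
    (hZ0 : (0 : Fin n ⊕ Fin m → ℝ) ∈ Z₀)
    (hZsub : ∀ z ∈ Z₀, (fun i => z (Sum.inl i)) ∈ 𝕏 ∧ (fun i => z (Sum.inr i)) ∈ 𝕌)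
    (hinv1 : ∀ j : ℕ, j + 2 ≤ M → ∀ z ∈ Z₀,
      (fun i => (((A0mat A B) ^ j * A1mat A B K).mulVec z) (Sum.inl i)) ∈ 𝕏 ∧
      (fun i => (((A0mat A B) ^ j * A1mat A B K).mulVec z) (Sum.inr i)) ∈ 𝕌)
    (hinv2 : ∀ z ∈ Z₀, ((A0mat A B) ^ (M - 1) * A1mat A B K).mulVec z ∈ Z₀)
    (hK : ∀ z ∈ Z₀, K.mulVec z ∈ 𝕌)
    -- cost matrices and Variant-1 terminal cost conditions
    (Q : Matrix (Fin n) (Fin n) ℝ) (R : Matrix (Fin m) (Fin m) ℝ)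
    (hQ : Q.PosDef) (hR : R.PosDef)
    (P₀ : Matrix (Fin n ⊕ Fin m) (Fin n ⊕ Fin m) ℝ) (hP₀ : P₀.PosSemidef)
    (hMI : (-((A1mat A B K)ᵀ * ((A0mat A B) ^ (M - 1))ᵀ * P₀ * (A0mat A B) ^ (M - 1) *
            A1mat A B K
          - P₀ + fromBlocks Q 0 0 0 + Kᵀ * R * K
          + ∑ j ∈ Finset.Icc 1 (M - 1),
              (A1mat A B K)ᵀ * ((A0mat A B) ^ (j - 1))ᵀ * fromBlocks Q 0 0 R *
                (A0mat A B) ^ (j - 1) * A1mat A B K)).PosSemidef)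
    -- modified terminal cost with a small penalty on the bucket level
    (σ : ℝ) (hσ : 0 < σ)
    -- cyclic prediction horizon with maximum length `Nb ≥ M`
    (Nb : ℕ) (hNb : M ≤ Nb)
    -- closed loop generated by Algorithm 1
    (ξcl : ℕ → NCSState n m) (πcl : ℕ → NCSInput n m)
    (hcl : ∀ k : ℕ, ξcl (k + 1) = ncsDyn A B g c b (ξcl k) (πcl k))
    -- whenever the OCP at time `k` is feasible, `π(k)` is the first element
    -- of a minimizer of the OCP at time `k` (with modified terminal cost)
    (hopt : ∀ k : ℕ,
      (∃ πs : ℕ → NCSInput n m, FeasOCP A B g c b 𝕏 𝕌 (ξcl k) (Nb - k % M)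
        {ξ : NCSState n m | vcat ξ.1 ξ.2.1 ∈ Z₀ ∧
          (c : ℤ) - (g : ℤ) ≤ ξ.2.2 ∧ ξ.2.2 ≤ (b : ℤ)} πs) →
      ∃ πs : ℕ → NCSInput n m,
        FeasOCP A B g c b 𝕏 𝕌 (ξcl k) (Nb - k % M)
          {ξ : NCSState n m | vcat ξ.1 ξ.2.1 ∈ Z₀ ∧
            (c : ℤ) - (g : ℤ) ≤ ξ.2.2 ∧ ξ.2.2 ≤ (b : ℤ)} πs ∧
        (∀ πs' : ℕ → NCSInput n m,
          FeasOCP A B g c b 𝕏 𝕌 (ξcl k) (Nb - k % M)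
            {ξ : NCSState n m | vcat ξ.1 ξ.2.1 ∈ Z₀ ∧
              (c : ℤ) - (g : ℤ) ≤ ξ.2.2 ∧ ξ.2.2 ≤ (b : ℤ)} πs' →
          costGen A B g c b Q R
              (fun ξ => vcat ξ.1 ξ.2.1 ⬝ᵥ P₀.mulVec (vcat ξ.1 ξ.2.1) +
                σ * ((b : ℝ) ^ 2 - (ξ.2.2 : ℝ) ^ 2))
              (ξcl k) (Nb - k % M) πs ≤
            costGen A B g c b Q R
              (fun ξ => vcat ξ.1 ξ.2.1 ⬝ᵥ P₀.mulVec (vcat ξ.1 ξ.2.1) +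
                σ * ((b : ℝ) ^ 2 - (ξ.2.2 : ℝ) ^ 2))
              (ξcl k) (Nb - k % M) πs') ∧
        πcl k = πs 0)
    -- feasibility of the OCP at time `0`
    (hfeas0 : ∃ πs : ℕ → NCSInput n m, FeasOCP A B g c b 𝕏 𝕌 (ξcl 0) (Nb - 0 % M)
      {ξ : NCSState n m | vcat ξ.1 ξ.2.1 ∈ Z₀ ∧
        (c : ℤ) - (g : ℤ) ≤ ξ.2.2 ∧ ξ.2.2 ≤ (b : ℤ)} πs) :
    -- (i) the OCP is feasible at every time `k`
    (∀ k : ℕ, ∃ πs : ℕ → NCSInput n m, FeasOCP A B g c b 𝕏 𝕌 (ξcl k) (Nb - k % M)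
      {ξ : NCSState n m | vcat ξ.1 ξ.2.1 ∈ Z₀ ∧
        (c : ℤ) - (g : ℤ) ≤ ξ.2.2 ∧ ξ.2.2 ≤ (b : ℤ)} πs) ∧
    -- (ii) state and input constraints and the token bucket TS are fulfilled
    (∀ k : ℕ, (ξcl k).1 ∈ 𝕏 ∧ (ξcl k).2.1 ∈ 𝕌 ∧
      0 ≤ (ξcl k).2.2 ∧ (ξcl k).2.2 ≤ (b : ℤ) ∧ (πcl k).1 ∈ 𝕌) ∧
    -- (iii) `(x(k), u(k)) → (0, 0)` as `k → ∞`
    Filter.Tendsto (fun k => ((ξcl k).1, (ξcl k).2.1)) Filter.atTop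
      (nhds (0, 0)) ∧
    -- (iv) if `c/g ∉ ℕ`, the bucket level converges to the upper sector
    (¬ g ∣ c → ∃ K₀ : ℕ, ∀ k ≥ K₀,
      max 0 ((b : ℤ) - (Nb : ℤ) * (g : ℤ)) ≤ (ξcl k).2.2 ∧
      (ξcl k).2.2 ≤ (b : ℤ)) := by
  have hg0 : (0 : ℚ) < g := by exact_mod_cast hg
  have hMg : c ≤ M * g := by
    have h1 := Nat.le_ceil ((c : ℚ) / (g : ℚ))
    rw [← hM, div_le_iff₀ hg0] at h1
    exact_mod_cast h1
  have hM1 : 1 ≤ M := by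
    rcases Nat.eq_zero_or_pos M with h | h
    · subst h
      omega
    · exact h
  clear hM
  set S : Set (NCSState n m) := {ξ : NCSState n m | vcat ξ.1 ξ.2.1 ∈ Z₀ ∧
        (c : ℤ) - (g : ℤ) ≤ ξ.2.2 ∧ ξ.2.2 ≤ (b : ℤ)} with hS
  set Vf : NCSState n m → ℝ := fun ξ => vcat ξ.1 ξ.2.1 ⬝ᵥ P₀.mulVec (vcat ξ.1 ξ.2.1) +
                σ * ((b : ℝ) ^ 2 - (ξ.2.2 : ℝ) ^ 2) with hVf
  -- one-step descent
  have hstep : ∀ k πs, FeasOCP A B g c b 𝕏 𝕌 (ξcl k) (Nb - k % M) S πs → πcl k = πs 0 →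
      ∃ πs', FeasOCP A B g c b 𝕏 𝕌 (ξcl (k + 1)) (Nb - (k + 1) % M) S πs' ∧
        costGen A B g c b Q R Vf (ξcl (k + 1)) (Nb - (k + 1) % M) πs' +
          stageCost Q R (ξcl k) (πcl k) +
          (if k % M + 1 = M ∧ ¬ g ∣ c ∧
            (ncsTraj A B g c b (ξcl k) πs (Nb - k % M)).2.2 < (b : ℤ) then σ else 0) ≤
        costGen A B g c b Q R Vf (ξcl k) (Nb - k % M) πs := by
    intro k πs hf h0
    have hlt : k % M < M := Nat.mod_lt _ hM1
    by_cases hk : k % M + 1 < M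
    · have hk1 : (k + 1) % M = k % M + 1 := by
        conv_lhs => rw [← Nat.div_add_mod k M, add_assoc, Nat.mul_add_mod, Nat.mod_eq_of_lt hk]
      have hN : Nb - k % M = (Nb - (k + 1) % M) + 1 := by omega
      rw [hN] at hf ⊢
      obtain ⟨hs, hc⟩ := ocp_shift A B g c b 𝕏 𝕌 Q R Vf S _ _ πs hf
      rw [hcl, h0]
      refine ⟨_, hs, ?_⟩
      rw [if_neg (by omega), hc]
      linarith
    · have hk2 : k % M + 1 = M := by omega
      have hk1 : (k + 1) % M = 0 := by
        conv_lhs => rw [← Nat.div_add_mod k M, add_assoc, Nat.mul_add_mod, hk2, Nat.mod_self]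
      have hN : Nb - k % M = (Nb - M) + 1 := by omega
      have hN' : Nb - (k + 1) % M = (Nb - M) + M := by omega
      rw [hN] at hf ⊢
      rw [hN']
      obtain ⟨hs, hc⟩ := ocp_shift A B g c b 𝕏 𝕌 Q R Vf S _ _ πs hf
      have hT := hf.2
      rw [ncsTraj_shift] at hT
      obtain ⟨ps, hps, hpc⟩ := base_step A B g c b hg hgc K M hM1 hMg 𝕏 𝕌 hU0 Z₀ hZsub hinv1
        hinv2 hK Q R P₀ hMI σ hσ _ hT
      obtain ⟨πs', hf', hc'⟩ := ocp_concat A B g c b 𝕏 𝕌 Q R Vf S _ _ _ _ _ hs hps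
      rw [hcl, h0]
      refine ⟨πs', hf', ?_⟩
      rw [hc', hc, ncsTraj_shift]
      simp only [hk2, true_and]
      change _ ≤ Vf _ at hpc
      linarith
  have hfeas : ∀ k : ℕ, ∃ πs, FeasOCP A B g c b 𝕏 𝕌 (ξcl k) (Nb - k % M) S πs := by
    intro k
    induction k with
    | zero => exact hfeas0
    | succ k ih =>
      obtain ⟨πs, h1, _, h3⟩ := hopt k ih
      obtain ⟨πs', h4, _⟩ := hstep k πs h1 h3
      exact ⟨πs', h4⟩
  choose p hpf hpo hp0 using fun k => hopt k (hfeas k)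
  have hNpos : ∀ k, 0 < Nb - k % M := fun k => by
    have := Nat.mod_lt k hM1
    omega
  have hcons : ∀ k : ℕ, (ξcl k).1 ∈ 𝕏 ∧ (ξcl k).2.1 ∈ 𝕌 ∧
      0 ≤ (ξcl k).2.2 ∧ (ξcl k).2.2 ≤ (b : ℤ) ∧ (πcl k).1 ∈ 𝕌 := by
    intro k
    rw [hp0 k]
    exact (hpf k).1 0 (hNpos k)
  set V : ℕ → ℝ := fun k => costGen A B g c b Q R Vf (ξcl k) (Nb - k % M) (p k) with hV
  set d : ℕ → ℝ := fun k => if k % M + 1 = M ∧ ¬ g ∣ c ∧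
      (ncsTraj A B g c b (ξcl k) (p k) (Nb - k % M)).2.2 < (b : ℤ) then σ else 0 with hd
  set l : ℕ → ℝ := fun k => stageCost Q R (ξcl k) (πcl k) with hl
  have hdesc : ∀ k, V (k + 1) + l k + d k ≤ V k := by
    intro k
    obtain ⟨πs', h1, h2⟩ := hstep k (p k) (hpf k) (hp0 k)
    have h3 := hpo (k + 1) πs' h1
    simp only [hV, hl, hd]
    linarith
  have hst : ∀ (ξ : NCSState n m) π, 0 ≤ stageCost Q R ξ π := by
    intro ξ π
    rw [stageCost_eq A B g c b]
    exact add_nonneg (posDef_nonneg Q hQ _) (posDef_nonneg R hR _)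
  have hd0 : ∀ k, 0 ≤ d k := by
    intro k
    simp only [hd]
    split_ifs
    · exact hσ.le
    · exact le_rfl
  have hV0 : ∀ k, 0 ≤ V k := by
    intro k
    refine add_nonneg (Finset.sum_nonneg fun i _ => hst _ _) ?_
    obtain ⟨-, h1, h2⟩ := (hpf k).2
    set ξT := ncsTraj A B g c b (ξcl k) (p k) (Nb - k % M)
    refine add_nonneg (by simpa using hP₀.dotProduct_mulVec_nonneg _) (mul_nonneg hσ.le ?_)
    have h3 : (0 : ℤ) ≤ ξT.2.2 := by omega
    have h4 : (0 : ℝ) ≤ ξT.2.2 := by exact_mod_cast h3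
    have h5 : (ξT.2.2 : ℝ) ≤ b := by exact_mod_cast h2
    nlinarith
  have hsum : ∀ k, ∑ i ∈ Finset.range k, (l i + d i) ≤ V 0 - V k := by
    intro k
    induction k with
    | zero => simp
    | succ k ih =>
      rw [Finset.sum_range_succ]
      have := hdesc k
      linarith
  have hsm : Summable (fun i => l i + d i) :=
    summable_of_sum_range_le (c := V 0) (fun i => add_nonneg (hst _ _) (hd0 i)) fun k => by
      have := hsum k
      have := hV0 k
      linarith
  have htend := hsm.tendsto_atTop_zero
  have hle : ∀ k, l k = (ξcl k).1 ⬝ᵥ Q.mulVec (ξcl k).1 +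
      (ξcl (k + 1)).2.1 ⬝ᵥ R.mulVec (ξcl (k + 1)).2.1 := by
    intro k
    rw [hcl k]
    exact stageCost_eq A B g c b Q R _ _
  refine ⟨hfeas, hcons, ?_, ?_⟩
  · rw [nhds_prod_eq]
    refine Filter.Tendsto.prodMk ?_ ?_
    · refine posDef_tendsto Q hQ _ (squeeze_zero (fun k => posDef_nonneg Q hQ _) (fun k => ?_) htend)
      have h1 := hle k
      have h2 := hd0 k
      have h3 := posDef_nonneg R hR (ξcl (k + 1)).2.1
      linarith
    · refine (Filter.tendsto_add_atTop_iff_nat 1).mp ?_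
      refine posDef_tendsto R hR _ (squeeze_zero (fun k => posDef_nonneg R hR _) (fun k => ?_) htend)
      have h1 := hle k
      have h2 := hd0 k
      have h3 := posDef_nonneg Q hQ (ξcl k).1
      linarith
  · intro hndvd
    obtain ⟨K₀, hK₀⟩ := Filter.eventually_atTop.mp (htend.eventually (gt_mem_nhds hσ))
    refine ⟨K₀, fun k hk => ⟨max_le (hcons k).2.2.1 ?_, (hcons k).2.2.2.1⟩⟩
    have hlt : k % M < M := Nat.mod_lt _ hM1
    obtain ⟨j, hj⟩ : ∃ j, k % M + j + 1 = M := ⟨M - 1 - k % M, by omega⟩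
    have hkj : (k + j) % M = k % M + j := by
      conv_lhs => rw [← Nat.div_add_mod k M, add_assoc, Nat.mul_add_mod,
        Nat.mod_eq_of_lt (show k % M + j < M by omega)]
    have hT : (b : ℤ) ≤ (ncsTraj A B g c b (ξcl (k + j)) (p (k + j)) (Nb - (k + j) % M)).2.2 := by
      by_contra hcon
      have h1 := hK₀ (k + j) (by omega)
      have h2 : d (k + j) = σ := if_pos ⟨by omega, hndvd, not_le.mp hcon⟩
      have h3 : 0 ≤ l (k + j) := hst _ _
      linarith
    have h1 := traj_beta_le A B g c b (ξcl (k + j)) (p (k + j)) (Nb - (k + j) % M)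
    have hclt : ∀ i, ξcl (k + i) = ncsTraj A B g c b (ξcl k) (fun i => πcl (k + i)) i := by
      intro i
      induction i with
      | zero => rfl
      | succ i ih =>
        rw [← add_assoc, hcl, ih]
        rfl
    have h2 := traj_beta_le A B g c b (ξcl k) (fun i => πcl (k + i)) j
    rw [← hclt] at h2
    have h3 : (((Nb - (k + j) % M : ℕ) : ℤ) + j) * g ≤ Nb * g := by
      apply mul_le_mul_of_nonneg_right _ (by positivity)
      omega
    rw [add_mul] at h3
    linarith
end
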